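/- Let μ be a probability measure with density proportional to exp(−V), and suppose W : ℝ^d → S⁺_d is a Stein kernel of μ with mean m = ∫ x dμ. Then div(W(x)) − W(x)∇V(x) = −(x − m) for μ-almost every x, where div(W) = (Σ_j ∂_j W_{ij})_i. Consequently the Riemannian Langevin SDE dX_t = (div(W) − W∇V) dt + √(2W) dB_t simplifies to the gradient-free dynamics dX_t = −(X_t − m) dt + √(2W(X_t)) dB_t. -/

import Mathlib

open MeasureTheory

lemma aux_grad {d : ℕ} {f : EuclideanSpace ℝ (Fin d) → ℝ} {x : EuclideanSpace ℝ (Fin d)} 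
    (j : Fin d) :
    gradient f x j = fderiv ℝ f x (EuclideanSpace.single j (1 : ℝ)) := by
  have h : inner ℝ (gradient f x) (EuclideanSpace.single j (1 : ℝ)) =
      fderiv ℝ f x (EuclideanSpace.single j (1 : ℝ)) := by
    simp only [gradient, InnerProductSpace.toDual_symm_apply]
  rw [← h, EuclideanSpace.inner_single_right]
  simp

/-- If `W` is a (smooth) Stein kernel of `μ ∝ exp(-V)` with mean `m`, then
`div(W(x)) - W(x)∇V(x) = -(x - m)` for `μ`-almost every `x`; hence the Riemannian
Langevin SDE `dX = (div W - W∇V) dt + √(2W) dB` simplifies to the gradient-free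
dynamics `dX = -(X - m) dt + √(2W(X)) dB`. -/
theorem stein_kernel_drift_simplification
    {d : ℕ}
    (V : EuclideanSpace ℝ (Fin d) → ℝ) (hV : ContDiff ℝ (⊤ : ℕ∞) V)
    (c : ℝ) (hc : 0 < c)
    (μ : Measure (EuclideanSpace ℝ (Fin d))) [IsProbabilityMeasure μ]
    (hμ : μ = volume.withDensity (fun x => ENNReal.ofReal (c * Real.exp (-V x))))
    (W : EuclideanSpace ℝ (Fin d) → Matrix (Fin d) (Fin d) ℝ)
    (hWpsd : ∀ x, (W x).PosSemidef)
    (hWsmooth : ∀ i j, ContDiff ℝ (⊤ : ℕ∞) (fun x => W x i j))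
    (m : Fin d → ℝ) (hm : ∀ i, m i = ∫ x, x i ∂μ)
    (hmInt : ∀ i, Integrable (fun x => x i) μ)
    -- W is a Stein kernel of μ (tested on smooth compactly supported functions)
    (hStein : ∀ f : EuclideanSpace ℝ (Fin d) → ℝ,
      ContDiff ℝ (⊤ : ℕ∞) f → HasCompactSupport f →
      ∀ i, ∫ x, (x i - m i) * f x ∂μ = ∫ x, ∑ j, W x i j * gradient f x j ∂μ) :
    ∀ᵐ x ∂μ, ∀ i,
      (∑ j, fderiv ℝ (fun y => W y i j) x (EuclideanSpace.single j (1 : ℝ))) -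
          (∑ j, W x i j * gradient V x j) = -(x i - m i) := by
  have hac : μ ≪ volume := hμ ▸ withDensity_absolutelyContinuous _ _
  refine Filter.Eventually.filter_mono hac.ae_le ?_
  refine Filter.eventually_all.mpr ?_
  intro i
  set ρ : EuclideanSpace ℝ (Fin d) → ℝ := fun x => c * Real.exp (-V x) with hρ
  have hρs : ContDiff ℝ (⊤ : ℕ∞) ρ := contDiff_const.mul hV.neg.exp
  have hρpos : ∀ x, 0 < ρ x := fun x => by positivity
  have hint : ∀ g : EuclideanSpace ℝ (Fin d) → ℝ, ∫ x, g x ∂μ = ∫ x, ρ x * g x := by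
    intro g
    rw [hμ, integral_withDensity_eq_integral_toReal_smul]
    · refine integral_congr_ae (Filter.Eventually.of_forall fun x => ?_)
      simp only [smul_eq_mul]
      rw [ENNReal.toReal_ofReal (hρpos x).le]
    · exact hρs.continuous.measurable.ennreal_ofReal
    · exact Filter.Eventually.of_forall fun x => ENNReal.ofReal_lt_top
  have hP : ∀ j, ContDiff ℝ (⊤ : ℕ∞) (fun x => ρ x * W x i j) := fun j => hρs.mul (hWsmooth i j)
  have hcoord : Continuous fun x : EuclideanSpace ℝ (Fin d) => x i - m i := by fun_prop
  have hPd : ∀ j, Continuous fun x => fderiv ℝ (fun y => ρ y * W y i j) x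
      (EuclideanSpace.single j (1 : ℝ)) := fun j =>
    ((hP j).continuous_fderiv (by simp)).clm_apply continuous_const
  have key : ∀ᵐ x : EuclideanSpace ℝ (Fin d), ρ x * (x i - m i) +
      ∑ j, fderiv ℝ (fun y => ρ y * W y i j) x (EuclideanSpace.single j (1 : ℝ)) = 0 := by
    have hG : Continuous fun x : EuclideanSpace ℝ (Fin d) => ρ x * (x i - m i) +
      ∑ j, fderiv ℝ (fun y => ρ y * W y i j) x (EuclideanSpace.single j (1 : ℝ)) :=
      (hρs.continuous.mul hcoord).add (continuous_finsetSum _ fun j _ => hPd j)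
    refine ae_eq_zero_of_integral_contDiff_smul_eq_zero hG.locallyIntegrable ?_
    intro f hf hfc
    have hfd : ∀ j, Continuous fun x => fderiv ℝ f x (EuclideanSpace.single j (1 : ℝ)) := fun j =>
      (hf.continuous_fderiv (by simp)).clm_apply continuous_const
    have hfdc : ∀ j : Fin d, HasCompactSupport
        fun x => fderiv ℝ f x (EuclideanSpace.single j (1 : ℝ)) := fun j =>
      hfc.fderiv_apply (𝕜 := ℝ) _
    have I1 : ∀ j, Integrable fun x => (ρ x * W x i j) *
        fderiv ℝ f x (EuclideanSpace.single j (1 : ℝ)) := fun j =>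
      ((hP j).continuous.mul (hfd j)).integrable_of_hasCompactSupport (hfdc j).mul_left
    have I2 : ∀ j, Integrable fun x => fderiv ℝ (fun y => ρ y * W y i j) x
        (EuclideanSpace.single j (1 : ℝ)) * f x := fun j =>
      ((hPd j).mul hf.continuous).integrable_of_hasCompactSupport hfc.mul_left
    have I3 : ∀ j, Integrable fun x => (ρ x * W x i j) * f x := fun j =>
      ((hP j).continuous.mul hf.continuous).integrable_of_hasCompactSupport hfc.mul_left
    have I4 : Integrable fun x => ρ x * ((x i - m i) * f x) :=
      (hρs.continuous.mul (hcoord.mul hf.continuous)).integrable_of_hasCompactSupport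
        hfc.mul_left.mul_left
    have h := hStein f hf hfc i
    rw [hint, hint] at h
    have e1 : ∫ x, ρ x * ∑ j, W x i j * gradient f x j =
        - ∑ j, ∫ x, fderiv ℝ (fun y => ρ y * W y i j) x
        (EuclideanSpace.single j (1 : ℝ)) * f x := by
      rw [← Finset.sum_neg_distrib]
      simp_rw [Finset.mul_sum, aux_grad, ← mul_assoc]
      rw [integral_finsetSum _ fun j _ => I1 j]
      refine Finset.sum_congr rfl fun j _ => ?_
      exact integral_mul_fderiv_eq_neg_fderiv_mul_of_integrable (I2 j) (I1 j) (I3 j)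
        (fun x _ => ((hP j).differentiable (by simp)).differentiableAt)
        (fun x _ => (hf.differentiable (by simp)).differentiableAt)
    have e2 : ∀ x : EuclideanSpace ℝ (Fin d), f x • (ρ x * (x i - m i) +
      ∑ j, fderiv ℝ (fun y => ρ y * W y i j) x (EuclideanSpace.single j (1 : ℝ))) =
      ρ x * ((x i - m i) * f x) + ∑ j, fderiv ℝ (fun y => ρ y * W y i j) x
        (EuclideanSpace.single j (1 : ℝ)) * f x := by
      intro x
      rw [← Finset.sum_mul, smul_eq_mul]; ring
    simp_rw [e2]
    rw [integral_add I4 (integrable_finsetSum _ fun j _ => I2 j),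
      integral_finsetSum _ fun j _ => I2 j, h, e1]
    ring
  filter_upwards [key] with x hx
  have hVd : DifferentiableAt ℝ V x := (hV.differentiable (by simp)).differentiableAt
  have hρd : HasFDerivAt ρ (-(ρ x) • fderiv ℝ V x) x := by
    have := (hVd.hasFDerivAt.neg.exp).const_mul c
    refine HasFDerivAt.congr_fderiv (f := ρ) this ?_
    ext v
    simp [hρ, mul_assoc]
  have hj : ∀ j, fderiv ℝ (fun y => ρ y * W y i j) x (EuclideanSpace.single j (1 : ℝ)) =
      ρ x * (fderiv ℝ (fun y => W y i j) x (EuclideanSpace.single j (1 : ℝ)) -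
        W x i j * gradient V x j) := by
    intro j
    have hw : DifferentiableAt ℝ (fun y => W y i j) x :=
      ((hWsmooth i j).differentiable (by simp)).differentiableAt
    have hp : HasFDerivAt (fun y => ρ y * W y i j)
        (ρ x • fderiv ℝ (fun y => W y i j) x + W x i j • (-(ρ x) • fderiv ℝ V x)) x :=
      hρd.mul hw.hasFDerivAt
    rw [hp.fderiv, aux_grad]
    simp only [ContinuousLinearMap.add_apply, ContinuousLinearMap.smul_apply, smul_eq_mul]
    ring
  simp_rw [hj] at hx
  rw [← Finset.mul_sum, ← mul_add, Finset.sum_sub_distrib] at hx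
  have := (mul_eq_zero.mp hx).resolve_left (hρpos x).ne'
  linarith
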